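/- Let g_{q,r₁}, g_{q,r₂} : K → K be standard Klein bottle maps with the same fibre degree q (so the difference of fibre degrees is 0). Then MCC_B(g_{q,r₁}, g_{q,r₂}) = 0 if r₁ ≠ r₂, and MCC_B(g_{q,r₁}, g_{q,r₂}) = 1 if r₁ = r₂. (The q = 0 case of Theorem 1.3(ii).) -/

import Mathlib

noncomputable section

abbrev Circle1 : Type := AddCircle (1 : ℝ)

/-- The relation on `ℝ × S¹` whose quotient is the Klein bottle:
`(t, z) ∼ (t + n, (-1)ⁿ • z)` for `n : ℤ`. -/
def kleinRel : (ℝ × Circle1) → (ℝ × Circle1) → Prop :=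
  fun a b => ∃ n : ℤ, b = (a.1 + n, (((-1 : ℤˣ) ^ n : ℤˣ) : ℤ) • a.2)

/-- The Klein bottle, as the quotient of `ℝ × S¹` by `kleinRel`. -/
abbrev KleinBottle : Type := Quot kleinRel

lemma coe_int_add (x : ℝ) (n : ℤ) : ((x + n : ℝ) : Circle1) = (x : Circle1) := by
  have h : ((n : ℝ) : Circle1) = 0 := by
    rw [AddCircle.coe_eq_zero_iff]; exact ⟨n, by simp⟩
  rw [QuotientAddGroup.mk_add, h, add_zero]

/-- The half point `1/2` of `S¹`, which is its own negative. -/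
def half : Circle1 := ((1/2 : ℝ) : Circle1)

lemma neg_half : -half = half := by
  rw [half, ← QuotientAddGroup.mk_neg]
  have : ((-(1/2) + 1 : ℝ) : Circle1) = ((-(1/2) : ℝ) : Circle1) := AddCircle.coe_add_period 1 _
  rw [← this]; norm_num

lemma units_smul_self_neg (u : ℤˣ) (z : Circle1) (hz : -z = z) : (u : ℤ) • z = z := by
  rcases Int.units_eq_one_or u with h | h <;> rw [h] <;> simp [hz]

/-- The projection `p_K : K → S¹` of the Klein bottle, induced by `(t, z) ↦ (t mod 1)`. -/
def pK : C(KleinBottle, Circle1) :=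
  ⟨Quot.lift (fun a => (a.1 : Circle1)) (by
      rintro a b ⟨n, rfl⟩
      exact (coe_int_add a.1 n).symm),
    continuous_quot_lift _ (continuous_coinduced_rng.comp continuous_fst)⟩

/-- A self map of the Klein bottle is a map over `S¹` if it commutes with `p_K`. -/
def KleinOverCircle (f : C(KleinBottle, KleinBottle)) : Prop := ∀ x, pK (f x) = pK x

/-- Two self-maps of `K` over `S¹` are homotopic over `S¹` if there is a homotopy between
them through maps over `S¹`. -/
def KleinHomotopicOver (f g : C(KleinBottle, KleinBottle)) : Prop :=
  ∃ H : ContinuousMap.Homotopy f g,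
    ∀ (s : unitInterval) (x : KleinBottle), pK (H (s, x)) = pK x

/-- The standard fibre-preserving self map `g_{q,r}` of the Klein bottle, induced by
`(t, z) ↦ (t, q • z + r • (1/2))`. -/
def kleinStdMap (q r : ℤ) : C(KleinBottle, KleinBottle) :=
  ⟨Quot.lift (fun a => Quot.mk kleinRel (a.1, q • a.2 + r • half))
    (by
      rintro a b ⟨n, rfl⟩
      apply Quot.sound
      refine ⟨n, ?_⟩
      simp only [Prod.mk.injEq, true_and]
      rw [smul_add, smul_comm ((((-1 : ℤˣ) ^ n : ℤˣ) : ℤ)) q,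
        units_smul_self_neg _ (r • half) (by rw [← smul_neg, neg_half])]),
    continuous_quot_lift _ ((continuous_quot_mk).comp (by fun_prop))⟩


open scoped Cardinal

/-- The minimum number `MCC_B(f₁, f₂)` of path components of the coincidence set, over all
pairs of maps homotopic over `S¹` to `f₁` and `f₂` respectively. -/
def MCCKlein (f₁ f₂ : C(KleinBottle, KleinBottle)) : Cardinal :=
  ⨅ p : {p : C(KleinBottle, KleinBottle) × C(KleinBottle, KleinBottle) //
      KleinHomotopicOver f₁ p.1 ∧ KleinHomotopicOver f₂ p.2},
    #(ZerothHomotopy {x : KleinBottle | p.1.1 x = p.1.2 x})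

lemma kleinRel_equivalence : Equivalence kleinRel where
  refl a := ⟨0, by simp⟩
  symm := by
    rintro a b ⟨n, rfl⟩
    refine ⟨-n, Prod.ext (by simp) ?_⟩
    simp [smul_smul, ← Units.val_mul]
  trans := by
    rintro a b c ⟨m, rfl⟩ ⟨n, rfl⟩
    refine ⟨m + n, Prod.ext (by push_cast; ring) ?_⟩
    simp [smul_smul, ← Units.val_mul, zpow_add, mul_comm]

lemma kleinMk_eq_iff {a b : ℝ × Circle1} :
    Quot.mk kleinRel a = Quot.mk kleinRel b ↔ kleinRel a b :=
  kleinRel_equivalence.quot_mk_eq_iff a b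

lemma kleinMk_injective (t : ℝ) : Function.Injective fun z => Quot.mk kleinRel (t, z) := by
  intro z w h
  obtain ⟨n, hn⟩ := kleinMk_eq_iff.1 h
  simp only [Prod.mk.injEq] at hn
  obtain rfl : n = 0 := by simpa using hn.1
  simpa using hn.2.symm

lemma kleinMk_one (z : Circle1) : Quot.mk kleinRel (1, z) = Quot.mk kleinRel (0, -z) :=
  kleinMk_eq_iff.2 ⟨-1, by simp⟩

lemma isOpenMap_kleinMk : IsOpenMap (Quot.mk kleinRel) := by
  intro U hU
  rw [← isQuotientMap_quot_mk.isOpen_preimage]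
  have h : Quot.mk kleinRel ⁻¹' (Quot.mk kleinRel '' U) =
      ⋃ n : ℤ, (fun a : ℝ × Circle1 =>
        (a.1 + (n : ℝ), (((-1 : ℤˣ) ^ n : ℤˣ) : ℤ) • a.2)) ⁻¹' U := by
    ext a
    simp only [Set.mem_preimage, Set.mem_image, Set.mem_iUnion]
    constructor
    · rintro ⟨u, hu, h⟩
      obtain ⟨n, rfl⟩ := kleinMk_eq_iff.1 h.symm
      exact ⟨n, hu⟩
    · rintro ⟨n, hn⟩
      exact ⟨_, hn, (Quot.sound ⟨n, rfl⟩ : Quot.mk kleinRel a = _).symm⟩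
  rw [h]
  exact isOpen_iUnion fun n => hU.preimage (by fun_prop)

lemma exists_eq_kleinMk {x : KleinBottle} {t : ℝ} (h : pK x = (t : Circle1)) :
    ∃ z, x = Quot.mk kleinRel (t, z) := by
  induction x using Quot.ind with | mk a =>
  have h' : (a.1 : Circle1) = (t : Circle1) := h
  obtain ⟨n, hn⟩ := (AddCircle.coe_eq_zero_iff (1 : ℝ) (x := t - a.1)).1 (by
    rw [AddCircle.coe_sub, h', sub_self])
  refine ⟨(((-1 : ℤˣ) ^ n : ℤˣ) : ℤ) • a.2, Quot.sound ⟨n, Prod.ext ?_ rfl⟩⟩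
  simp only [zsmul_eq_mul, mul_one] at hn
  linarith

/-- A continuous map into the Klein bottle whose projection to the base circle lifts to `ℝ`
has a continuous fibre coordinate. -/
lemma exists_continuous_fibre_coordinate {X : Type*} [TopologicalSpace X] {γ : X → KleinBottle}
    {τ : X → ℝ} (hγ : Continuous γ) (hτ : Continuous τ) (h : ∀ x, pK (γ x) = (τ x : Circle1)) :
    ∃ ζ : X → Circle1, Continuous ζ ∧ ∀ x, γ x = Quot.mk kleinRel (τ x, ζ x) := by
  choose ζ hζ using fun x => exists_eq_kleinMk (h x)
  refine ⟨ζ, continuous_iff_continuousAt.2 fun x₀ => ?_, hζ⟩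
  rw [ContinuousAt, (nhds_basis_opens _).tendsto_right_iff]
  rintro V ⟨hx₀, hV⟩
  have hU := isOpenMap_kleinMk _ ((Metric.isOpen_ball (x := τ x₀) (ε := 1 / 4)).prod hV)
  filter_upwards [hγ.continuousAt.preimage_mem_nhds (hU.mem_nhds
      ⟨(τ x₀, ζ x₀), ⟨Metric.mem_ball_self (by norm_num), hx₀⟩, (hζ x₀).symm⟩),
    hτ.continuousAt.preimage_mem_nhds (Metric.ball_mem_nhds (τ x₀) (by norm_num : (0 : ℝ) < 1 / 4))]
    with x hx hτx
  obtain ⟨⟨t, z⟩, ⟨ht, hz⟩, htz⟩ := hx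
  rw [hζ x] at htz
  obtain ⟨n, hn⟩ := kleinMk_eq_iff.1 htz
  simp only [Prod.mk.injEq] at hn
  simp only [Set.mem_preimage, Metric.mem_ball, Real.dist_eq, abs_lt] at ht hτx
  have h₁ : (n : ℝ) < 1 := by linarith
  have h₂ : (-1 : ℝ) < n := by linarith
  obtain rfl : n = 0 := by
    have h₁' : n < 1 := by exact_mod_cast h₁
    have h₂' : -1 < n := by exact_mod_cast h₂
    lia
  have hzx : ζ x = z := by simpa using hn.2
  exact hzx ▸ hz

/-- A homotopy of antiperiodic circle-valued functions starting at `0` ends at a function with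
a zero. -/
lemma exists_eq_zero_of_antiperiodic_homotopy (δ : C(unitInterval × ℝ, Circle1))
    (h0 : ∀ t, δ (0, t) = 0) (h : ∀ s, δ (s, 1) = -δ (s, 0)) : ∃ t, δ (1, t) = 0 := by
  have cov := AddCircle.isCoveringMap_coe (1 : ℝ)
  have hδ0 : ∀ t, δ (0, t) = (((0 : C(ℝ, ℝ)) t : ℝ) : Circle1) := by simpa using h0
  set D := cov.liftHomotopy δ 0 hδ0
  have hD : ∀ x, ((D x : ℝ) : Circle1) = δ x := congrFun (cov.liftHomotopy_lifts δ 0 hδ0)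
  have hD0 : ∀ t, D (0, t) = 0 := cov.liftHomotopy_zero δ 0 hδ0
  have hsum : (fun s => D (s, 1) + D (s, 0)) = fun _ => (0 : ℝ) :=
    cov.eq_of_comp_eq (by fun_prop) continuous_const (by ext s; simp [hD, h]) 0 (by simp [hD0])
  have h1 : D (1, 1) = -D (1, 0) := eq_neg_of_add_eq_zero_left (congrFun hsum 1)
  have hcont : Continuous fun t => D (1, t) := by fun_prop
  obtain ⟨t, ht⟩ : (0 : ℝ) ∈ Set.range fun t => D (1, t) := by
    rcases le_total (D (1, 0)) 0 with h' | h'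
    · exact mem_range_of_exists_le_of_exists_ge hcont ⟨0, h'⟩ ⟨1, by simp only [h1]; linarith⟩
    · exact mem_range_of_exists_le_of_exists_ge hcont ⟨1, by simp only [h1]; linarith⟩ ⟨0, h'⟩
  exact ⟨t, by rw [← hD, show D (1, t) = 0 from ht, AddCircle.coe_zero]⟩

/-- Maps homotopic over `S¹` to the same map have a coincidence. -/
lemma exists_coincidence {g f₁ f₂ : C(KleinBottle, KleinBottle)} (h₁ : KleinHomotopicOver g f₁) (h₂ : KleinHomotopicOver g f₂) : ∃ x, f₁ x = f₂ x := by
  obtain ⟨H₁, hH₁⟩ := h₁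
  obtain ⟨H₂, hH₂⟩ := h₂
  let σ : ℝ → KleinBottle := fun t => Quot.mk kleinRel (t, 0)
  have hσ : Continuous σ := continuous_quot_mk.comp (by fun_prop)
  have hσ1 : σ 1 = σ 0 := by simpa using kleinMk_one 0
  obtain ⟨ζ₁, hζ₁, e₁⟩ := exists_continuous_fibre_coordinate
    (γ := fun x : unitInterval × ℝ => H₁ (x.1, σ x.2)) (by fun_prop) continuous_snd
    fun x => hH₁ x.1 (σ x.2)
  obtain ⟨ζ₂, hζ₂, e₂⟩ := exists_continuous_fibre_coordinate
    (γ := fun x : unitInterval × ℝ => H₂ (x.1, σ x.2)) (by fun_prop) continuous_snd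
    fun x => hH₂ x.1 (σ x.2)
  have anti : ∀ (H : unitInterval × KleinBottle → KleinBottle) (ζ : unitInterval × ℝ → Circle1),
      (∀ x, H (x.1, σ x.2) = Quot.mk kleinRel (x.2, ζ x)) → ∀ s, ζ (s, 1) = -ζ (s, 0) := by
    intro H ζ e s
    have h := e (s, 1)
    simp only [hσ1] at h
    rw [e (s, 0), kleinMk_one] at h
    rw [kleinMk_injective 0 h, neg_neg]
  obtain ⟨t, ht⟩ := exists_eq_zero_of_antiperiodic_homotopy ⟨fun x => ζ₁ x - ζ₂ x, by fun_prop⟩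
    (fun t => by
      refine sub_eq_zero.2 (kleinMk_injective t ?_)
      change Quot.mk kleinRel (t, ζ₁ (0, t)) = Quot.mk kleinRel (t, ζ₂ (0, t))
      rw [← e₁ (0, t), ← e₂ (0, t)]
      simp)
    (fun s => by
      simp only [ContinuousMap.coe_mk, anti H₁ ζ₁ e₁ s, anti H₂ ζ₂ e₂ s]
      abel)
  refine ⟨σ t, ?_⟩
  have h := (e₁ (1, t)).trans ((congrArg (fun z => Quot.mk kleinRel (t, z))
    (sub_eq_zero.1 ht)).trans (e₂ (1, t)).symm)
  simpa using h

lemma kleinStdMap_overCircle (q r : ℤ) : KleinOverCircle (kleinStdMap q r) := by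
  rintro ⟨a⟩
  rfl

lemma KleinHomotopicOver.refl {f : C(KleinBottle, KleinBottle)} (hf : KleinOverCircle f) :
    KleinHomotopicOver f f :=
  ⟨ContinuousMap.Homotopy.refl f, fun _ x => hf x⟩

lemma half_ne_zero : half ≠ 0 := by
  intro h
  obtain ⟨n, hn⟩ := AddCircle.coe_eq_zero_iff (1 : ℝ) |>.1 h
  have h2 : ((2 * n : ℤ) : ℝ) = (1 : ℤ) := by
    push_cast
    simp only [zsmul_eq_mul, mul_one] at hn
    linarith
  have := Int.cast_injective h2
  lia

lemma kleinStdMap_ne (q : ℤ) {r₁ r₂ : ℤ} (hr₁ : r₁ = 0 ∨ r₁ = 1) (hr₂ : r₂ = 0 ∨ r₂ = 1)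
    (h : r₁ ≠ r₂) (x : KleinBottle) : kleinStdMap q r₁ x ≠ kleinStdMap q r₂ x := by
  induction x using Quot.ind with | mk a =>
  intro hx
  have hz := add_left_cancel (kleinMk_injective a.1 hx)
  rcases hr₁ with rfl | rfl <;> rcases hr₂ with rfl | rfl <;>
    simp [half_ne_zero, half_ne_zero.symm] at h hz

lemma pathConnectedSpace_kleinBottle : PathConnectedSpace KleinBottle :=
  Quot.mk_surjective.pathConnectedSpace (f := Quot.mk kleinRel) continuous_quot_mk

/-- Theorem 1.3(ii), case `q = 0`: for standard Klein bottle maps `g_{q,r₁}`, `g_{q,r₂}` with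
the same fibre degree `q`, the minimum number of coincidence components over `S¹` is `0` if
`r₁ ≠ r₂` and `1` if `r₁ = r₂`. -/
theorem klein_MCC_of_eq_degree (q r₁ r₂ : ℤ)
    (hr₁ : r₁ = 0 ∨ r₁ = 1) (hr₂ : r₂ = 0 ∨ r₂ = 1) :
    MCCKlein (kleinStdMap q r₁) (kleinStdMap q r₂) = if r₁ ≠ r₂ then 0 else 1 := by
  have hg := kleinStdMap_overCircle q
  split_ifs with h
  · refine le_antisymm ?_ zero_le
    refine (ciInf_le' _ ⟨(kleinStdMap q r₁, kleinStdMap q r₂),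
      .refl (hg r₁), .refl (hg r₂)⟩).trans ?_
    rw [nonpos_iff_eq_zero, Cardinal.mk_eq_zero_iff, ZerothHomotopy]
    have : IsEmpty {x | kleinStdMap q r₁ x = kleinStdMap q r₂ x} :=
      ⟨fun x => kleinStdMap_ne q hr₁ hr₂ h x.1 x.2⟩
    infer_instance
  · obtain rfl := not_not.1 h
    have : Nonempty {p : C(KleinBottle, KleinBottle) × C(KleinBottle, KleinBottle) //
        KleinHomotopicOver (kleinStdMap q r₁) p.1 ∧ KleinHomotopicOver (kleinStdMap q r₁) p.2} :=
      ⟨⟨(kleinStdMap q r₁, kleinStdMap q r₁), .refl (hg r₁), .refl (hg r₁)⟩⟩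
    refine le_antisymm ?_ (le_ciInf fun ⟨p, h₁, h₂⟩ => ?_)
    · refine (ciInf_le' _ ⟨(kleinStdMap q r₁, kleinStdMap q r₁),
        .refl (hg r₁), .refl (hg r₁)⟩).trans ?_
      have := pathConnectedSpace_kleinBottle
      have hC : PathConnectedSpace {x | kleinStdMap q r₁ x = kleinStdMap q r₁ x} := by
        rw [← isPathConnected_iff_pathConnectedSpace]
        simpa using isPathConnected_univ
      exact Cardinal.le_one_iff_subsingleton.2 (pathConnectedSpace_iff_zerothHomotopy.1 hC).2
    · obtain ⟨x, hx⟩ := exists_coincidence h₁ h₂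
      exact Cardinal.one_le_iff_ne_zero.2 (Cardinal.mk_ne_zero_iff.2 ⟨.mk ⟨x, hx⟩⟩)
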